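/- Let p, q, r ∈ (0, 1/36) be such that the system S_pqr has unique one-point intersection and does not satisfy the open set condition. Then, with s the similarity dimension of S_pqr (the unique s > 0 with p^s + q^s + 4·r^s = 1), the s-dimensional Hausdorff measure of the attractor vanishes: H^s(K_pqr) = 0, even though dim_H K_pqr = s. -/

import Mathlib

open Set MeasureTheory

/-- The system `S_pqr = {S_1,…,S_6}` of similarities of `ℝ` (0-indexed: index `i : Fin 6`
corresponds to `S_{i+1}`), with `a = 1/5` and `h = 8/15`. -/
noncomputable def Spqr (p q r : ℝ) : Fin 6 → ℝ → ℝ :=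
  ![fun x => p * x,
    fun x => 1/5 + r * x,
    fun x => 8/15 - q * x,
    fun x => 8/15 - r + r * x,
    fun x => 1 - 1/5 - r * x,
    fun x => 1 - r + r * x]

/-- The open set condition for a system of six maps of `ℝ`. -/
def SatisfiesOSC (T : Fin 6 → ℝ → ℝ) : Prop :=
  ∃ O : Set ℝ, O.Nonempty ∧ IsOpen O ∧ (∀ i, T i '' O ⊆ O) ∧
    ∀ i j : Fin 6, i ≠ j → (T i '' O) ∩ (T j '' O) = ∅

/-- `K` is the attractor of the system `T`. -/
def IsAttractor (T : Fin 6 → ℝ → ℝ) (K : Set ℝ) : Prop :=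
  K.Nonempty ∧ IsCompact K ∧ K = ⋃ i, T i '' K

/-- `S_pqr` (with attractor `K`) has unique one-point intersection:
`K₃ ∩ K₄ = {8/15}` (indices `2, 3` here) and all other pairwise intersections of
distinct pieces are empty. -/
def UniqueOnePointIntersection (p q r : ℝ) (K : Set ℝ) : Prop :=
  (Spqr p q r 2 '' K) ∩ (Spqr p q r 3 '' K) = {8/15} ∧
    ∀ i j : Fin 6, i ≠ j → ({i, j} : Set (Fin 6)) ≠ {2, 3} →
      (Spqr p q r i '' K) ∩ (Spqr p q r j '' K) = ∅


open scoped ENNReal NNReal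
open Metric OuterMeasure

/-- The outer measure obtained from covers by sets of diameter at most `δ`, each set being
charged its diameter to the power `s`. -/
noncomputable def sizedContent (s : ℝ) (δ : ℝ≥0∞) : OuterMeasure ℝ :=
  OuterMeasure.mkMetric'.pre (fun E => ediam E ^ s) δ

theorem sizedContent_anti (s : ℝ) {δ δ' : ℝ≥0∞} (h : δ ≤ δ') (E : Set ℝ) :
    sizedContent s δ' E ≤ sizedContent s δ E :=
  mkMetric'.mono_pre _ h E

theorem hausdorffMeasure_eq_iSup_sizedContent (s : ℝ) (E : Set ℝ) :
    μH[s] E = ⨆ δ : ℝ≥0∞, ⨆ _ : δ > 0, sizedContent s δ E := by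
  rw [← Measure.coe_toOuterMeasure, Measure.hausdorffMeasure, Measure.mkMetric_toOuterMeasure,
    OuterMeasure.mkMetric, OuterMeasure.mkMetric']
  simp only [OuterMeasure.iSup_apply]
  rfl

theorem sizedContent_le_hausdorffMeasure (s : ℝ) {δ : ℝ≥0∞} (hδ : 0 < δ) (E : Set ℝ) :
    sizedContent s δ E ≤ μH[s] E := by
  rw [hausdorffMeasure_eq_iSup_sizedContent]
  exact le_iSup₂ (f := fun δ (_ : δ > 0) => sizedContent s δ E) δ hδ

theorem sizedContent_le_of_ediam_le {s : ℝ} {δ : ℝ≥0∞} {E : Set ℝ} (h : ediam E ≤ δ) :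
    sizedContent s δ E ≤ ediam E ^ s :=
  mkMetric'.pre_le h

theorem sizedContent_image_le {s : ℝ} (hs : 0 < s) {ρ : ℝ≥0} (hρ : ρ ≠ 0) {f : ℝ → ℝ}
    (hf : LipschitzWith ρ f) {δ δ' : ℝ≥0∞} (h : ρ * δ ≤ δ') (E : Set ℝ) :
    sizedContent s δ' (f '' E) ≤ (ρ : ℝ≥0∞) ^ s * sizedContent s δ E := by
  have h0 : (ρ : ℝ≥0∞) ^ s ≠ 0 := by
    simp [ENNReal.rpow_eq_zero_iff, hρ, hs.not_gt]
  have h1 : (ρ : ℝ≥0∞) ^ s ≠ ∞ := by simp [ENNReal.rpow_eq_top_iff, hs.not_gt, hρ]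
  have key : ((ρ : ℝ≥0∞) ^ s)⁻¹ • OuterMeasure.comap f (sizedContent s δ')
      ≤ sizedContent s δ := by
    refine mkMetric'.le_pre.2 fun V hV => ?_
    simp only [_root_.smul_apply, OuterMeasure.comap_apply, smul_eq_mul]
    have hd := hf.ediam_image_le V
    rw [mul_comm, ← div_eq_mul_inv]
    refine ENNReal.div_le_of_le_mul ?_
    calc sizedContent s δ' (f '' V) ≤ ediam (f '' V) ^ s :=
          sizedContent_le_of_ediam_le (hd.trans ((mul_le_mul_right hV _).trans h))
      _ ≤ (ρ * ediam V) ^ s := ENNReal.rpow_le_rpow hd hs.le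
      _ = ediam V ^ s * ρ ^ s := by rw [ENNReal.mul_rpow_of_nonneg _ _ hs.le, mul_comm]
  have := key E
  simp only [_root_.smul_apply, OuterMeasure.comap_apply, smul_eq_mul] at this
  rw [mul_comm, ← div_eq_mul_inv, ENNReal.div_le_iff h0 h1] at this
  rwa [mul_comm]

/-- A set of small content has an economical cover by open sets. -/
theorem exists_open_cover_of_sizedContent_lt {s : ℝ} (hs : 0 < s) {δ δ' : ℝ≥0∞} (h : δ < δ')
    {c : ℝ≥0∞} {E : Set ℝ} (hE : sizedContent s δ E < c) :
    ∃ U : ℕ → Set ℝ, (∀ n, IsOpen (U n)) ∧ E ⊆ ⋃ n, U n ∧ (∀ n, ediam (U n) ≤ δ') ∧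
      ∑' n, ediam (U n) ^ s < c := by
  rw [sizedContent, mkMetric'.pre, boundedBy_apply] at hE
  simp only [iInf_lt_iff] at hE
  obtain ⟨t, ht, hsum⟩ := hE
  set S := ∑' n, ⨆ _ : (t n).Nonempty, extend (fun V (_ : ediam V ≤ δ) => ediam V ^ s) (t n)
    with hS
  have hle : ∀ n, ediam (t n) ≤ δ ∧ ediam (t n) ^ s ≤
      ⨆ _ : (t n).Nonempty, extend (fun V (_ : ediam V ≤ δ) => ediam V ^ s) (t n) := by
    intro n
    rcases (t n).eq_empty_or_nonempty with hn | hn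
    · simp [hn, hs]
    · have hd : ediam (t n) ≤ δ := by
        by_contra hd
        have h1 : (⨆ _ : (t n).Nonempty,
            extend (fun V (_ : ediam V ≤ δ) => ediam V ^ s) (t n)) = ∞ := by
          simp [hn, extend, hd]
        have h2 : S = ∞ := ENNReal.tsum_eq_top_of_eq_top ⟨n, h1⟩
        exact absurd hsum (by simp [h2])
      exact ⟨hd, by simp [hn, extend, hd]⟩
  have hS' : ∑' n, ediam (t n) ^ s < c := (ENNReal.tsum_le_tsum fun n => (hle n).2).trans_lt hsum
  obtain ⟨ε, hε, hεsum⟩ := ENNReal.exists_pos_sum_of_countable (tsub_pos_of_lt hS').ne' ℕ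
  have hη : ∀ n, ∃ η : ℝ≥0, 0 < η ∧ ediam (t n) + 2 * η ≤ δ' ∧
      (ediam (t n) + 2 * η) ^ s ≤ ediam (t n) ^ s + ε n := by
    intro n
    have hlt : ediam (t n) < δ' := (hle n).1.trans_lt h
    have hcont : Continuous fun η : ℝ≥0 => ediam (t n) + 2 * (η : ℝ≥0∞) := by
      refine continuous_const.add ?_
      exact (ENNReal.continuous_const_mul (by simp)).comp ENNReal.continuous_coe
    have hcont' : Continuous fun η : ℝ≥0 => (ediam (t n) + 2 * (η : ℝ≥0∞)) ^ s :=
      (ENNReal.continuous_rpow_const).comp hcont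
    have hfin : ediam (t n) ^ s ≠ ∞ := by
      simp [ENNReal.rpow_eq_top_iff, hs.not_gt, hlt.ne_top]
    have e1 := (hcont.tendsto 0).eventually_lt_const (u := δ') (by simpa using hlt)
    have e2 := (hcont'.tendsto 0).eventually_lt_const (u := ediam (t n) ^ s + ε n)
      (by simpa using ENNReal.lt_add_right hfin (by simpa using (hε n).ne'))
    have e3 := (e1.and e2).filter_mono (nhdsWithin_le_nhds (s := Ioi 0))
    obtain ⟨η, ⟨h1, h2⟩, h3⟩ := (e3.and self_mem_nhdsWithin).exists
    exact ⟨η, h3, h1.le, h2.le⟩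
  choose η hη0 hη1 hη2 using hη
  refine ⟨fun n => thickening (η n) (t n), fun n => isOpen_thickening, ?_, ?_, ?_⟩
  · exact ht.trans (iUnion_mono fun n => self_subset_thickening (by exact_mod_cast hη0 n) _)
  · exact fun n => (ediam_thickening_le _).trans (hη1 n)
  · calc ∑' n, ediam (thickening (η n) (t n)) ^ s
        ≤ ∑' n, (ediam (t n) ^ s + ε n) := ENNReal.tsum_le_tsum fun n =>
          (ENNReal.rpow_le_rpow (ediam_thickening_le _) hs.le).trans (hη2 n)
      _ = ∑' n, ediam (t n) ^ s + ∑' n, (ε n : ℝ≥0∞) := ENNReal.tsum_add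
      _ < ∑' n, ediam (t n) ^ s + (c - ∑' n, ediam (t n) ^ s) :=
          ENNReal.add_lt_add_left hS'.ne_top hεsum
      _ = c := add_tsub_cancel_of_le hS'.le

/-- `f` multiplies all distances by `ρ > 0`. -/
def IsSimilarity (ρ : ℝ≥0) (f : ℝ → ℝ) : Prop :=
  ρ ≠ 0 ∧ ∀ x y, edist (f x) (f y) = ρ * edist x y

namespace IsSimilarity

variable {ρ σ : ℝ≥0} {f g : ℝ → ℝ}

theorem lipschitzWith (hf : IsSimilarity ρ f) : LipschitzWith ρ f := fun x y => (hf.2 x y).le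

theorem antilipschitzWith (hf : IsSimilarity ρ f) : AntilipschitzWith ρ⁻¹ f := fun x y => by
  rw [hf.2, ← mul_assoc, ← ENNReal.coe_mul, inv_mul_cancel₀ hf.1, ENNReal.coe_one, one_mul]

theorem comp (hf : IsSimilarity ρ f) (hg : IsSimilarity σ g) : IsSimilarity (ρ * σ) (f ∘ g) :=
  ⟨mul_ne_zero hf.1 hg.1, fun x y => by simp [hf.2, hg.2, mul_assoc]⟩

theorem injective (hf : IsSimilarity ρ f) : Function.Injective f :=
  hf.antilipschitzWith.injective

theorem ediam_preimage_rpow_le (hf : IsSimilarity ρ f) {t : ℝ} (ht : 0 < t) (V : Set ℝ) :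
    (ρ : ℝ≥0∞) ^ t * ediam (f ⁻¹' V) ^ t ≤ ediam V ^ t := by
  rw [← ENNReal.mul_rpow_of_nonneg _ _ ht.le]
  refine ENNReal.rpow_le_rpow ?_ ht.le
  calc (ρ : ℝ≥0∞) * ediam (f ⁻¹' V) ≤ ρ * ((ρ⁻¹ : ℝ≥0) * ediam V) := by
        gcongr
        exact hf.antilipschitzWith.ediam_preimage_le V
    _ = ediam V := by
        rw [← mul_assoc, ← ENNReal.coe_mul, mul_inv_cancel₀ hf.1, ENNReal.coe_one, one_mul]

theorem hausdorffMeasure_image (hf : IsSimilarity ρ f) {s : ℝ} (hs : 0 < s) (E : Set ℝ) :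
    μH[s] (f '' E) = (ρ : ℝ≥0∞) ^ s * μH[s] E := by
  refine le_antisymm (hf.lipschitzWith.hausdorffMeasure_image_le hs.le E) ?_
  calc (ρ : ℝ≥0∞) ^ s * μH[s] E
      ≤ (ρ : ℝ≥0∞) ^ s * (((ρ⁻¹ : ℝ≥0) : ℝ≥0∞) ^ s * μH[s] (f '' E)) := by
        gcongr
        exact hf.antilipschitzWith.le_hausdorffMeasure_image hs.le E
    _ = μH[s] (f '' E) := by
        rw [← mul_assoc, ← ENNReal.mul_rpow_of_nonneg _ _ hs.le, ← ENNReal.coe_mul,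
          mul_inv_cancel₀ hf.1, ENNReal.coe_one, ENNReal.one_rpow, one_mul]

end IsSimilarity

theorem isSimilarity_affine {b c : ℝ} (hc : c ≠ 0) :
    IsSimilarity (Real.nnabs c) (fun x => b + c * x) := by
  refine ⟨by simpa using hc, fun x y => ?_⟩
  have h : ((Real.nnabs c : ℝ≥0) : ℝ≥0∞) = ENNReal.ofReal |c| := by
    rw [ENNReal.ofReal, ← Real.coe_nnabs, Real.toNNReal_coe]
  rw [h, edist_dist, edist_dist, ← ENNReal.ofReal_mul (abs_nonneg c), Real.dist_eq, Real.dist_eq,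
    ← abs_mul]
  ring_nf

section Separated

variable {ι : Type*} [Fintype ι] {T : ι → ℝ → ℝ} {ρ : ι → ℝ≥0} {K : Set ℝ}

/-- Finite covers of a set invariant under a separated family of similarities are not cheap. -/
theorem rpow_le_sum_ediam_of_separated (hT : ∀ i, IsSimilarity (ρ i) (T i))
    (hρ : ∀ i, ρ i < 1) (hK : K.Nonempty) (hTK : ∀ i, T i '' K ⊆ K) {δ : ℝ≥0∞}
    (hδ : ∀ i j, i ≠ j → ∀ x ∈ T i '' K, ∀ y ∈ T j '' K, δ ≤ edist x y)
    {t : ℝ} (ht : 0 < t) (hsum : 1 ≤ ∑ i, (ρ i : ℝ≥0∞) ^ t) (F : Finset ℕ) (U : ℕ → Set ℝ)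
    (hU : K ⊆ ⋃ n ∈ F, U n) : δ ^ t ≤ ∑ n ∈ F, ediam (U n) ^ t := by
  classical
  induction hn : F.card using Nat.strong_induction_on generalizing F U with
  | _ n ih =>
  by_cases hbig : ∃ j ∈ F, δ ≤ ediam (U j)
  · obtain ⟨j, hj, hd⟩ := hbig
    exact (ENNReal.rpow_le_rpow hd ht.le).trans
      (Finset.single_le_sum (f := fun n => ediam (U n) ^ t) (fun _ _ => zero_le) hj)
  push Not at hbig
  set G : ι → Finset ℕ := fun i => F.filter fun j => (U j ∩ T i '' K).Nonempty with hG
  have hGF : ∀ i, G i ⊆ F := fun i => Finset.filter_subset _ _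
  have hdisj : ∀ i j, i ≠ j → Disjoint (G i) (G j) := by
    intro i j hij
    rw [Finset.disjoint_left]
    intro m hmi hmj
    obtain ⟨hmF, x, hxU, hx⟩ := Finset.mem_filter.1 hmi
    obtain ⟨-, y, hyU, hy⟩ := Finset.mem_filter.1 hmj
    exact absurd ((hδ i j hij x hx y hy).trans (edist_le_ediam_of_mem hxU hyU))
      (hbig m hmF).not_ge
  have hcov : ∀ i, K ⊆ ⋃ n ∈ G i, T i ⁻¹' U n := by
    intro i x hx
    obtain ⟨m, hm, hxm⟩ := mem_iUnion₂.1 (hU (hTK i (mem_image_of_mem _ hx)))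
    exact mem_iUnion₂.2 ⟨m, Finset.mem_filter.2 ⟨hm, _, hxm, mem_image_of_mem _ hx⟩, hxm⟩
  have hne : ∀ i, (G i).Nonempty := by
    intro i
    obtain ⟨x, hx⟩ := hK
    obtain ⟨m, hm, -⟩ := mem_iUnion₂.1 (hcov i hx)
    exact ⟨m, hm⟩
  have htwo : ∀ i, ∃ j : ι, i ≠ j := by
    intro i
    by_contra! hall
    have hu : (Finset.univ : Finset ι) = {i} := by
      ext j
      simp [hall j]
    rw [hu, Finset.sum_singleton] at hsum
    refine absurd hsum (not_le.2 ?_)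
    exact ENNReal.rpow_lt_one (by exact_mod_cast hρ i) ht
  have hlt : ∀ i, (G i).card < n := by
    intro i
    obtain ⟨j, hij⟩ := htwo i
    obtain ⟨m, hm⟩ := hne j
    rw [← hn]
    exact Finset.card_lt_card ⟨hGF i, fun hsub =>
      Finset.disjoint_left.1 (hdisj i j hij) (hsub (hGF j hm)) hm⟩
  calc δ ^ t = 1 * δ ^ t := (one_mul _).symm
    _ ≤ (∑ i, (ρ i : ℝ≥0∞) ^ t) * δ ^ t := by gcongr
    _ = ∑ i, (ρ i : ℝ≥0∞) ^ t * δ ^ t := Finset.sum_mul _ _ _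
    _ ≤ ∑ i, ∑ m ∈ G i, ediam (U m) ^ t := by
        refine Finset.sum_le_sum fun i _ => ?_
        calc (ρ i : ℝ≥0∞) ^ t * δ ^ t
            ≤ (ρ i : ℝ≥0∞) ^ t * ∑ m ∈ G i, ediam (T i ⁻¹' U m) ^ t := by
              gcongr
              exact ih _ (hlt i) (G i) _ (hcov i) rfl
          _ = ∑ m ∈ G i, (ρ i : ℝ≥0∞) ^ t * ediam (T i ⁻¹' U m) ^ t := Finset.mul_sum _ _ _
          _ ≤ ∑ m ∈ G i, ediam (U m) ^ t :=
              Finset.sum_le_sum fun m _ => (hT i).ediam_preimage_rpow_le ht _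
    _ = ∑ m ∈ Finset.univ.biUnion G, ediam (U m) ^ t :=
        (Finset.sum_biUnion fun i _ j _ hij => hdisj i j hij).symm
    _ ≤ ∑ m ∈ F, ediam (U m) ^ t :=
        Finset.sum_le_sum_of_subset (Finset.biUnion_subset.2 fun i _ => hGF i)

/-- Lower bound for the Hausdorff dimension of a compact set mapped to disjoint parts of itself by
finitely many similarities. -/
theorem le_dimH_of_pairwise_disjoint_images (hT : ∀ i, IsSimilarity (ρ i) (T i))
    (hρ : ∀ i, ρ i < 1) (hK : K.Nonempty) (hKc : IsCompact K) (hTK : ∀ i, T i '' K ⊆ K)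
    (hdisj : ∀ i j, i ≠ j → Disjoint (T i '' K) (T j '' K)) {t : ℝ} (ht : 0 < t)
    (hsum : 1 ≤ ∑ i, (ρ i : ℝ≥0∞) ^ t) : ENNReal.ofReal t ≤ dimH K := by
  have hcomp : ∀ i, IsCompact (T i '' K) := fun i => hKc.image (hT i).lipschitzWith.continuous
  have hsep : ∀ ij : ι × ι, ∃ r : ℝ≥0, 0 < r ∧
      (ij.1 ≠ ij.2 → ∀ x ∈ T ij.1 '' K, ∀ y ∈ T ij.2 '' K, (r : ℝ≥0∞) < edist x y) := by
    rintro ⟨i, j⟩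
    by_cases hij : i = j
    · exact ⟨1, one_pos, fun h => absurd hij h⟩
    · obtain ⟨r, hr, h⟩ :=
        Metric.exists_pos_forall_lt_edist (hcomp i) (hcomp j).isClosed (hdisj i j hij)
      exact ⟨r, hr, fun _ => h⟩
  choose r hr0 hr using hsep
  have hev : ∀ᶠ δ : ℝ≥0 in nhdsWithin 0 (Ioi 0), ∀ ij, δ < r ij :=
    Filter.eventually_all.2 fun ij =>
      Filter.Eventually.filter_mono nhdsWithin_le_nhds (eventually_lt_nhds (hr0 ij))
  obtain ⟨δ, hδr, hδ0⟩ := (hev.and self_mem_nhdsWithin).exists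
  have hδ0' : 0 < δ := hδ0
  have hbound : ∀ (F : Finset ℕ) (U : ℕ → Set ℝ), K ⊆ ⋃ n ∈ F, U n → (δ : ℝ≥0∞) ^ t ≤ ∑ n ∈ F, ediam (U n) ^ t :=
    rpow_le_sum_ediam_of_separated hT hρ hK hTK (fun i j hij x hx y hy =>
      (ENNReal.coe_le_coe.2 (hδr (i, j)).le).trans (hr (i, j) hij x hx y hy).le) ht hsum
  have hpos : (0 : ℝ≥0∞) < (δ : ℝ≥0∞) ^ t :=
    ENNReal.rpow_pos (by exact_mod_cast hδ0') ENNReal.coe_ne_top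
  have hne : μH[t] K ≠ 0 := by
    intro h0
    have hc : sizedContent t 1 K < (δ : ℝ≥0∞) ^ t :=
      (sizedContent_le_hausdorffMeasure t one_pos K).trans_lt (h0.symm ▸ hpos)
    obtain ⟨U, hUo, hKU, -, hlt⟩ :=
      exists_open_cover_of_sizedContent_lt ht (ENNReal.one_lt_two) hc
    obtain ⟨F, hF⟩ := hKc.elim_finite_subcover U hUo hKU
    exact absurd ((hbound F U hF).trans (ENNReal.sum_le_tsum F)) hlt.not_ge
  have := le_dimH_of_hausdorffMeasure_ne_zero (d := t.toNNReal) (s := K)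
    (by rwa [Real.coe_toNNReal _ ht.le])
  exact this

end Separated

/-- The contraction ratios of `Spqr p q r`. -/
noncomputable def pqrRatio (p q r : ℝ) : Fin 6 → ℝ≥0 :=
  fun i => Real.toNNReal (![p, r, q, r, r, r] i)

theorem isSimilarity_of_affine {f : ℝ → ℝ} {b c ρ : ℝ} (hf : ∀ x, f x = b + c * x) (hc : c ≠ 0)
    (hρ : |c| = ρ) : IsSimilarity ρ.toNNReal f := by
  have h := isSimilarity_affine (b := b) hc
  have e : Real.nnabs c = ρ.toNNReal := by
    rw [← hρ, ← Real.coe_nnabs, Real.toNNReal_coe]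
  rw [e] at h
  exact (funext hf : f = _) ▸ h

section System

variable {p q r : ℝ} {K : Set ℝ}

theorem Spqr_isSimilarity (hp : 0 < p) (hq : 0 < q) (hr : 0 < r) (i : Fin 6) :
    IsSimilarity (pqrRatio p q r i) (Spqr p q r i) := by
  fin_cases i
  · exact isSimilarity_of_affine (b := 0) (c := p) (fun x => by simp [Spqr]) hp.ne'
      (abs_of_pos hp)
  · exact isSimilarity_of_affine (b := 1/5) (c := r) (fun x => by simp [Spqr]) hr.ne'
      (abs_of_pos hr)
  · exact isSimilarity_of_affine (b := 8/15) (c := -q) (fun x => by simp [Spqr]; ring)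
      (neg_ne_zero.2 hq.ne') (by rw [abs_neg]; exact abs_of_pos hq)
  · exact isSimilarity_of_affine (b := 8/15 - r) (c := r) (fun x => by simp [Spqr]) hr.ne'
      (abs_of_pos hr)
  · exact isSimilarity_of_affine (b := 1 - 1/5) (c := -r) (fun x => by simp [Spqr]; ring)
      (neg_ne_zero.2 hr.ne') (by rw [abs_neg]; exact abs_of_pos hr)
  · exact isSimilarity_of_affine (b := 1 - r) (c := r) (fun x => by simp [Spqr]) hr.ne'
      (abs_of_pos hr)

theorem pqrRatio_le (hp : p ≤ 1/36) (hq : q ≤ 1/36) (hr : r ≤ 1/36) (i : Fin 6) :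
    pqrRatio p q r i ≤ 36⁻¹ := by
  have h : ∀ x : ℝ, x ≤ 1/36 → x.toNNReal ≤ (36⁻¹ : ℝ≥0) := fun x hx => by
    rw [Real.toNNReal_le_iff_le_coe]
    push_cast
    linarith
  fin_cases i
  · exact h p hp
  · exact h r hr
  · exact h q hq
  · exact h r hr
  · exact h r hr
  · exact h r hr

theorem sum_pqrRatio_rpow (hp : 0 < p) (hq : 0 < q) (hr : 0 < r) (t : ℝ) :
    ∑ i, (pqrRatio p q r i : ℝ≥0∞) ^ t = ENNReal.ofReal (p ^ t + q ^ t + 4 * r ^ t) := by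
  have h : ∀ x : ℝ, 0 < x → ((x.toNNReal : ℝ≥0) : ℝ≥0∞) ^ t = ENNReal.ofReal (x ^ t) :=
    fun x hx => ENNReal.ofReal_rpow_of_pos hx
  have hsum : ∑ i, (pqrRatio p q r i : ℝ≥0∞) ^ t =
      ∑ i, ENNReal.ofReal ((![p, r, q, r, r, r] i) ^ t) := by
    refine Finset.sum_congr rfl fun i _ => ?_
    fin_cases i
    exacts [h p hp, h r hr, h q hq, h r hr, h r hr, h r hr]
  rw [hsum, ← ENNReal.ofReal_sum_of_nonneg]
  · congr 1
    simp [Fin.sum_univ_succ]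
    ring
  · intro i _
    fin_cases i <;> simp <;> positivity

/-- The left endpoints of intervals of length `1/36` containing the pieces of `Spqr p q r`. -/
noncomputable def pqrLeft : Fin 6 → ℝ :=
  ![0, 1/5, 8/15 - 1/36, 8/15 - 1/36, 4/5 - 1/36, 35/36]

theorem Spqr_mem_of_mem (hp : p ∈ Ioo (0:ℝ) (1/36)) (hq : q ∈ Ioo (0:ℝ) (1/36))
    (hr : r ∈ Ioo (0:ℝ) (1/36)) {x : ℝ} (hx : x ∈ Icc (0:ℝ) 1) (i : Fin 6) :
    Spqr p q r i x ∈ Icc (pqrLeft i) (pqrLeft i + 1/36) := by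
  obtain ⟨hp0, hp1⟩ := hp
  obtain ⟨hq0, hq1⟩ := hq
  obtain ⟨hr0, hr1⟩ := hr
  obtain ⟨hx0, hx1⟩ := hx
  have e1 : 0 ≤ p * x := by positivity
  have e2 : p * x ≤ p := mul_le_of_le_one_right hp0.le hx1
  have e3 : 0 ≤ q * x := by positivity
  have e4 : q * x ≤ q := mul_le_of_le_one_right hq0.le hx1
  have e5 : 0 ≤ r * x := by positivity
  have e6 : r * x ≤ r := mul_le_of_le_one_right hr0.le hx1
  fin_cases i <;> simp [Spqr, pqrLeft] <;> constructor <;> linarith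

theorem Spqr_disjoint_of_subset (hp : p ∈ Ioo (0:ℝ) (1/36)) (hq : q ∈ Ioo (0:ℝ) (1/36))
    (hr : r ∈ Ioo (0:ℝ) (1/36)) {E : Set ℝ} (hE : E ⊆ Icc 0 1) {i j : Fin 6} (hij : i ≠ j)
    (hne : ({i, j} : Set (Fin 6)) ≠ {2, 3}) :
    Spqr p q r i '' E ∩ Spqr p q r j '' E = ∅ := by
  rw [Set.eq_empty_iff_forall_notMem]
  rintro _ ⟨⟨x, hx, rfl⟩, y, hy, hxy⟩
  have h1 := Spqr_mem_of_mem hp hq hr (hE hx) i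
  have h2 := Spqr_mem_of_mem hp hq hr (hE hy) j
  rw [hxy] at h2
  obtain ⟨h3, h4⟩ := h1
  obtain ⟨h5, h6⟩ := h2
  have h7 := h3.trans h6
  have h8 := h5.trans h4
  clear h3 h4 h5 h6 hxy
  fin_cases i <;> fin_cases j <;>
    first
      | exact absurd rfl hij
      | exact absurd rfl hne
      | exact absurd (Set.pair_comm _ _) hne
      | (simp [pqrLeft] at h7 h8; linarith)

theorem IsAttractor.image_subset {T : Fin 6 → ℝ → ℝ} (hK : IsAttractor T K) (i : Fin 6) :
    T i '' K ⊆ K := by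
  conv_rhs => rw [hK.2.2]
  exact subset_iUnion (fun i => T i '' K) i

theorem IsAttractor.exists_eq {T : Fin 6 → ℝ → ℝ} (hK : IsAttractor T K) {x : ℝ} (hx : x ∈ K) :
    ∃ i, ∃ y ∈ K, T i y = x := by
  rw [hK.2.2] at hx
  exact mem_iUnion.1 hx

theorem IsAttractor.subset_Icc (hp : p ∈ Ioo (0:ℝ) (1/36)) (hq : q ∈ Ioo (0:ℝ) (1/36))
    (hr : r ∈ Ioo (0:ℝ) (1/36)) (hK : IsAttractor (Spqr p q r) K) : K ⊆ Icc 0 1 := by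
  obtain ⟨hp0, hp1⟩ := hp
  obtain ⟨hq0, hq1⟩ := hq
  obtain ⟨hr0, hr1⟩ := hr
  obtain ⟨M, hM, hMmax⟩ := hK.2.1.exists_isGreatest hK.1
  obtain ⟨m, hm, hmmin⟩ := hK.2.1.exists_isLeast hK.1
  obtain ⟨d, hd0, hd1, hd2, hd3⟩ : ∃ d, 0 ≤ d ∧ -m ≤ d ∧ M - 1 ≤ d ∧
      (d ≤ 0 ∨ d ≤ -m ∨ d ≤ M - 1) := by
    refine ⟨max 0 (max (-m) (M - 1)), by simp, by simp, by simp, ?_⟩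
    simp only [max_le_iff]
    rcases le_total (-m) (M - 1) with h | h <;> rcases le_total 0 (-m) with h' | h' <;>
      rcases le_total 0 (M - 1) with h'' | h'' <;> grind
  have key : ∀ i, ∀ y ∈ K, -(d / 36) ≤ Spqr p q r i y ∧ Spqr p q r i y ≤ 1 + d / 36 := by
    intro i y hy
    have h1 : 0 ≤ y + d := by linarith [hmmin hy]
    have h2 : 0 ≤ 1 + d - y := by linarith [hMmax hy]
    have b : ∀ c : ℝ, 0 < c → c < 1/36 → -(d / 36) ≤ c * y ∧ c * y ≤ 1/36 + d / 36 := by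
      intro c hc0 hc1
      constructor <;> nlinarith
    have bp := b p hp0 hp1
    have bq := b q hq0 hq1
    have br := b r hr0 hr1
    have br' : r * y ≤ r + d / 36 := by nlinarith
    fin_cases i <;> simp [Spqr] <;> constructor <;> linarith
  have hlo : -(d / 36) ≤ m := by
    obtain ⟨i, y, hy, h⟩ := hK.exists_eq hm
    exact h ▸ (key i y hy).1
  have hhi : M ≤ 1 + d / 36 := by
    obtain ⟨i, y, hy, h⟩ := hK.exists_eq hM
    exact h ▸ (key i y hy).2
  have hd : d ≤ 0 := by rcases hd3 with h | h | h <;> linarith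
  exact fun x hx => ⟨by linarith [hmmin hx], by linarith [hMmax hx]⟩

theorem UniqueOnePointIntersection.zero_mem (hq : q ≠ 0)
    (h : UniqueOnePointIntersection p q r K) : (0:ℝ) ∈ K := by
  have h1 : (8/15 : ℝ) ∈ Spqr p q r 2 '' K ∩ Spqr p q r 3 '' K := by rw [h.1]; rfl
  obtain ⟨⟨x, hx, hxe⟩, -⟩ := h1
  simp [Spqr, hq] at hxe
  exact hxe ▸ hx

theorem UniqueOnePointIntersection.eq_zero (hq : q ≠ 0) (h : UniqueOnePointIntersection p q r K)
    {x y : ℝ} (hx : x ∈ K) (hy : y ∈ K) (hxy : q * x = r * (1 - y)) : x = 0 := by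
  have h1 : Spqr p q r 2 x ∈ Spqr p q r 2 '' K ∩ Spqr p q r 3 '' K :=
    ⟨⟨x, hx, rfl⟩, y, hy, by simp [Spqr]; linarith⟩
  rw [h.1] at h1
  simpa [Spqr, hq] using h1

theorem hausdorffMeasure_attractor_le {s : ℝ} (hs : 0 < s) (hp : p ∈ Ioo (0:ℝ) (1/36))
    (hq : q ∈ Ioo (0:ℝ) (1/36)) (hr : r ∈ Ioo (0:ℝ) (1/36)) (hK : IsAttractor (Spqr p q r) K)
    (hsim : p ^ s + q ^ s + 4 * r ^ s = 1) : μH[s] K ≤ sizedContent s 1 K := by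
  have hstep : ∀ δ : ℝ≥0∞, sizedContent s (36⁻¹ * δ) K ≤ sizedContent s δ K := by
    intro δ
    calc sizedContent s (36⁻¹ * δ) K
        = sizedContent s (36⁻¹ * δ) (⋃ i, Spqr p q r i '' K) := by rw [← hK.2.2]
      _ ≤ ∑ i, sizedContent s (36⁻¹ * δ) (Spqr p q r i '' K) :=
          measure_iUnion_fintype_le _ _
      _ ≤ ∑ i, (pqrRatio p q r i : ℝ≥0∞) ^ s * sizedContent s δ K := by
          refine Finset.sum_le_sum fun i _ => ?_
          have hS := Spqr_isSimilarity hp.1 hq.1 hr.1 i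
          refine sizedContent_image_le hs hS.1 hS.lipschitzWith ?_ K
          gcongr
          have := ENNReal.coe_le_coe.2 (pqrRatio_le hp.2.le hq.2.le hr.2.le i)
          rwa [ENNReal.coe_inv (by norm_num)] at this
      _ = sizedContent s δ K := by
          rw [← Finset.sum_mul, sum_pqrRatio_rpow hp.1 hq.1 hr.1, hsim]
          simp
  have hpow : ∀ n : ℕ, sizedContent s ((36⁻¹ : ℝ≥0∞) ^ n) K ≤ sizedContent s 1 K := by
    intro n
    induction n with
    | zero => simp
    | succ n ih => rw [pow_succ']; exact (hstep _).trans ih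
  rw [hausdorffMeasure_eq_iSup_sizedContent]
  refine iSup₂_le fun δ hδ => ?_
  obtain ⟨n, hn⟩ := ENNReal.exists_inv_two_pow_lt hδ.ne'
  refine (sizedContent_anti s ?_ K).trans (hpow n)
  refine le_trans ?_ hn.le
  gcongr
  norm_num

theorem hausdorffMeasure_attractor_ne_top {s : ℝ} (hs : 0 < s) (hp : p ∈ Ioo (0:ℝ) (1/36))
    (hq : q ∈ Ioo (0:ℝ) (1/36)) (hr : r ∈ Ioo (0:ℝ) (1/36)) (hK : IsAttractor (Spqr p q r) K)
    (hsim : p ^ s + q ^ s + 4 * r ^ s = 1) : μH[s] K ≠ ∞ := by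
  have hd : ediam K ≤ 1 := (ediam_mono (hK.subset_Icc hp hq hr)).trans (by simp [Real.ediam_Icc])
  refine ne_top_of_le_ne_top ENNReal.one_ne_top ?_
  calc μH[s] K ≤ sizedContent s 1 K := hausdorffMeasure_attractor_le hs hp hq hr hK hsim
    _ ≤ ediam K ^ s := sizedContent_le_of_ediam_le hd
    _ ≤ 1 := ENNReal.rpow_le_one hd hs.le

theorem hausdorffMeasure_le_sizedContent_of_subset {s : ℝ} (hs : 0 < s)
    (hp : p ∈ Ioo (0:ℝ) (1/36)) (hq : q ∈ Ioo (0:ℝ) (1/36)) (hr : r ∈ Ioo (0:ℝ) (1/36))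
    (hK : IsAttractor (Spqr p q r) K) (hsim : p ^ s + q ^ s + 4 * r ^ s = 1) {A : Set ℝ}
    (hA : MeasurableSet A) (hAK : A ⊆ K) : μH[s] A ≤ sizedContent s 1 A := by
  have hfin := hausdorffMeasure_attractor_ne_top hs hp hq hr hK hsim
  have h : μH[s] A + μH[s] (K \ A) ≤ sizedContent s 1 A + μH[s] (K \ A) :=
    calc μH[s] A + μH[s] (K \ A) = μH[s] K := by
          rw [← measure_inter_add_sdiff K hA, inter_eq_self_of_subset_right hAK]
      _ ≤ sizedContent s 1 K := hausdorffMeasure_attractor_le hs hp hq hr hK hsim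
      _ ≤ sizedContent s 1 A + sizedContent s 1 (K \ A) := by
          conv_lhs => rw [← union_sdiff_cancel hAK]
          exact measure_union_le _ _
      _ ≤ sizedContent s 1 A + μH[s] (K \ A) := by
          gcongr
          exact sizedContent_le_hausdorffMeasure s one_pos _
  exact (ENNReal.add_le_add_iff_right
    (ne_top_of_le_ne_top hfin (measure_mono sdiff_subset))).1 h

/-- Words of a given length in the maps of `Spqr`, followed by `S₂`, map the attractor to pairwise
disjoint parts of it. -/
theorem exists_separated_subsystem (hp : p ∈ Ioo (0:ℝ) (1/36)) (hq : q ∈ Ioo (0:ℝ) (1/36))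
    (hr : r ∈ Ioo (0:ℝ) (1/36)) (hK : IsAttractor (Spqr p q r) K)
    (h1 : UniqueOnePointIntersection p q r K) (t : ℝ) (n : ℕ) :
    ∃ (ι : Type) (_ : Fintype ι) (T : ι → ℝ → ℝ) (ρ : ι → ℝ≥0),
      (∀ i, IsSimilarity (ρ i) (T i)) ∧ (∀ i, ρ i < 1) ∧ (∀ i, T i '' K ⊆ K) ∧
      (∀ i, (0:ℝ) ∉ T i '' K) ∧ (∀ i j, i ≠ j → Disjoint (T i '' K) (T j '' K)) ∧
      ∑ i, (ρ i : ℝ≥0∞) ^ t =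
        (∑ i, (pqrRatio p q r i : ℝ≥0∞) ^ t) ^ n * (r.toNNReal : ℝ≥0∞) ^ t := by
  have hS := Spqr_isSimilarity hp.1 hq.1 hr.1
  have hρ : ∀ i, pqrRatio p q r i < 1 := fun i =>
    (pqrRatio_le hp.2.le hq.2.le hr.2.le i).trans_lt (by norm_num)
  have hI := hK.subset_Icc hp hq hr
  have hnz : ∀ i x, x ∈ K → Spqr p q r i x = 0 → i = 0 ∧ x = 0 := by
    intro i x hx h0
    have hm := (Spqr_mem_of_mem hp hq hr (hI hx) i).1
    rw [h0] at hm
    fin_cases i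
    · exact ⟨rfl, by simpa [Spqr, hp.1.ne'] using h0⟩
    all_goals
      exfalso
      simp [pqrLeft] at hm
      linarith
  induction n with
  | zero =>
    refine ⟨Unit, inferInstance, fun _ => Spqr p q r 1, fun _ => pqrRatio p q r 1, fun _ => hS 1,
      fun _ => hρ 1, fun _ => hK.image_subset 1, ?_, fun i j hij => absurd rfl hij, ?_⟩
    · rintro _ ⟨x, hx, hx0⟩
      exact absurd (hnz 1 x hx hx0).1 (by decide)
    · simp [pqrRatio]
  | succ n ih =>
    obtain ⟨ι, hι, T, ρ, hT, hρ1, hTK, hT0, hTd, hsum⟩ := ih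
    refine ⟨Fin 6 × ι, inferInstance, fun w => Spqr p q r w.1 ∘ T w.2,
      fun w => pqrRatio p q r w.1 * ρ w.2, fun w => (hS w.1).comp (hT w.2), ?_, ?_, ?_, ?_, ?_⟩
    · exact fun w => mul_lt_one_of_nonneg_of_lt_one_left zero_le (hρ _) (hρ1 _).le
    · intro w
      rw [image_comp]
      exact (image_mono (hTK _)).trans (hK.image_subset _)
    · rintro w ⟨x, hx, hx0⟩
      exact hT0 w.2 ⟨x, hx, (hnz _ _ (hTK _ ⟨x, hx, rfl⟩) hx0).2⟩
    · rintro ⟨i, u⟩ ⟨j, v⟩ hne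
      rw [Set.disjoint_left]
      rintro _ ⟨x, hx, rfl⟩ ⟨y, hy, hxy⟩
      simp only [Function.comp_apply] at hxy
      have hx' : T u x ∈ T u '' K := ⟨x, hx, rfl⟩
      have hy' : T v y ∈ T v '' K := ⟨y, hy, rfl⟩
      have hh : ∀ z, Spqr p q r 2 z = 8/15 → z = 0 := fun z hz => by
        simpa [Spqr, hq.1.ne'] using hz
      by_cases hij : i = j
      · subst hij
        have huv : u ≠ v := fun h => hne (by rw [h])
        have := (hS i).injective hxy
        exact Set.disjoint_left.1 (hTd u v huv) hx' (this ▸ hy')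
      · have hmem : Spqr p q r i (T u x) ∈ Spqr p q r i '' K ∩ Spqr p q r j '' K :=
          ⟨⟨_, hTK u hx', rfl⟩, ⟨_, hTK v hy', hxy⟩⟩
        by_cases h23 : ({i, j} : Set (Fin 6)) = {2, 3}
        · have hcase : (i = 2 ∧ j = 3) ∨ (i = 3 ∧ j = 2) := Set.pair_eq_pair_iff.1 h23
          rcases hcase with ⟨rfl, rfl⟩ | ⟨rfl, rfl⟩
          · rw [h1.1] at hmem
            exact hT0 u (hh _ hmem ▸ hx')
          · rw [Set.inter_comm, h1.1, ← hxy] at hmem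
            exact hT0 v (hh _ hmem ▸ hy')
        · rw [h1.2 i j hij h23] at hmem
          exact hmem
    · rw [Fintype.sum_prod_type, pow_succ', mul_assoc, ← hsum, Finset.sum_mul_sum]
      refine Finset.sum_congr rfl fun i _ => Finset.sum_congr rfl fun j _ => ?_
      rw [ENNReal.coe_mul, ENNReal.mul_rpow_of_ne_zero]
      · exact_mod_cast (hS i).1
      · exact_mod_cast (hT j).1

theorem ofReal_le_dimH_attractor {s : ℝ} (hs : 0 < s) (hp : p ∈ Ioo (0:ℝ) (1/36))
    (hq : q ∈ Ioo (0:ℝ) (1/36)) (hr : r ∈ Ioo (0:ℝ) (1/36)) (hK : IsAttractor (Spqr p q r) K)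
    (h1 : UniqueOnePointIntersection p q r K) (hsim : p ^ s + q ^ s + 4 * r ^ s = 1) :
    ENNReal.ofReal s ≤ dimH K := by
  have main : ∀ t : ℝ, 0 < t → t < s → ENNReal.ofReal t ≤ dimH K := by
    intro t ht hts
    have hmono : ∀ x ∈ Ioo (0:ℝ) (1/36), x ^ s < x ^ t := fun x hx =>
      Real.rpow_lt_rpow_of_exponent_gt hx.1 (hx.2.trans (by norm_num)) hts
    have hc : 1 < p ^ t + q ^ t + 4 * r ^ t := by
      linarith [hmono p hp, hmono q hq, hmono r hr]
    have hrt : 0 < r ^ t := Real.rpow_pos_of_pos hr.1 t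
    obtain ⟨n, hn⟩ := pow_unbounded_of_one_lt (r ^ t)⁻¹ hc
    obtain ⟨ι, hι, T, ρ, hT, hρ1, hTK, -, hTd, hsum⟩ :=
      exists_separated_subsystem hp hq hr hK h1 t n
    refine le_dimH_of_pairwise_disjoint_images hT hρ1 hK.1 hK.2.1 hTK hTd ht ?_
    rw [hsum, sum_pqrRatio_rpow hp.1 hq.1 hr.1, ← ENNReal.ofReal_pow (by linarith),
      show ((r.toNNReal : ℝ≥0) : ℝ≥0∞) ^ t = ENNReal.ofReal (r ^ t) from
        ENNReal.ofReal_rpow_of_pos hr.1, ← ENNReal.ofReal_mul (by positivity),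
      ENNReal.one_le_ofReal]
    rw [inv_lt_iff_one_lt_mul₀ hrt] at hn
    linarith
  refine le_of_forall_lt fun c hc => ?_
  have hctop : c ≠ ∞ := hc.ne_top
  have hcs : c.toReal < s := by
    rwa [← ENNReal.ofReal_toReal hctop, ENNReal.ofReal_lt_ofReal_iff hs] at hc
  obtain ⟨t, hct, hts⟩ := exists_between hcs
  have ht : 0 < t := ENNReal.toReal_nonneg.trans_lt hct
  refine lt_of_lt_of_le ?_ (main t ht hts)
  rwa [← ENNReal.ofReal_toReal hctop, ENNReal.ofReal_lt_ofReal_iff ht]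

theorem IsAttractor.pow_mul_mem (hK : IsAttractor (Spqr p q r) K) {x : ℝ} (hx : x ∈ K) (m : ℕ) :
    p ^ m * x ∈ K := by
  induction m with
  | zero => simpa using hx
  | succ m ih => exact hK.image_subset 0 ⟨_, ih, by simp [Spqr]; ring⟩

theorem IsAttractor.one_sub_pow_mul_mem (hK : IsAttractor (Spqr p q r) K) {x : ℝ} (hx : x ∈ K)
    (n : ℕ) : 1 - r ^ n * (1 - x) ∈ K := by
  induction n with
  | zero => simpa using hx
  | succ n ih => exact hK.image_subset 5 ⟨_, ih, by simp [Spqr]; ring⟩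

theorem exists_pow_mul_eq_of_pos (hp : p ∈ Ioo (0:ℝ) (1/36)) (hq : q ∈ Ioo (0:ℝ) (1/36))
    (hr : r ∈ Ioo (0:ℝ) (1/36)) (hK : IsAttractor (Spqr p q r) K) {x : ℝ} (hx : x ∈ K)
    (hx0 : 0 < x) : ∃ m : ℕ, ∃ a ∈ K ∩ Icc (1/5) 1, x = p ^ m * a := by
  have hI := hK.subset_Icc hp hq hr
  have key : ∀ N : ℕ, ∀ x ∈ K, p ^ N < x → ∃ m : ℕ, ∃ a ∈ K ∩ Icc (1/5) 1, x = p ^ m * a := by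
    intro N
    induction N with
    | zero => exact fun x hx hlt => absurd (hI hx).2 (by simpa using hlt)
    | succ N ih =>
      intro x hx hlt
      by_cases h5 : 1/5 ≤ x
      · exact ⟨0, x, ⟨hx, h5, (hI hx).2⟩, by simp⟩
      · obtain ⟨i, y, hy, rfl⟩ := hK.exists_eq hx
        have hm := (Spqr_mem_of_mem hp hq hr (hI hy) i).1
        have hi : i = 0 := by
          fin_cases i
          · rfl
          all_goals
            exfalso
            simp [pqrLeft] at hm h5
            linarith
        subst hi
        have he : Spqr p q r 0 y = p * y := rfl
        rw [he, pow_succ'] at hlt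
        obtain ⟨m, a, ha, hya⟩ := ih y hy (lt_of_mul_lt_mul_left hlt hp.1.le)
        exact ⟨m + 1, a, ha, by rw [he, hya]; ring⟩
  obtain ⟨N, hN⟩ := exists_pow_lt_of_lt_one hx0 (hp.2.trans (by norm_num))
  exact key N x hx hN

theorem exists_pow_mul_eq_of_lt_one (hp : p ∈ Ioo (0:ℝ) (1/36)) (hq : q ∈ Ioo (0:ℝ) (1/36))
    (hr : r ∈ Ioo (0:ℝ) (1/36)) (hK : IsAttractor (Spqr p q r) K) {x : ℝ} (hx : x ∈ K)
    (hx1 : x < 1) : ∃ m : ℕ, ∃ b ∈ K ∩ Icc 0 (4/5), 1 - x = r ^ m * (1 - b) := by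
  have hI := hK.subset_Icc hp hq hr
  have key : ∀ N : ℕ, ∀ x ∈ K, r ^ N < 1 - x →
      ∃ m : ℕ, ∃ b ∈ K ∩ Icc 0 (4/5), 1 - x = r ^ m * (1 - b) := by
    intro N
    induction N with
    | zero =>
      intro x hx hlt
      have := (hI hx).1
      simp at hlt
      linarith
    | succ N ih =>
      intro x hx hlt
      by_cases h5 : x ≤ 4/5
      · exact ⟨0, x, ⟨hx, (hI hx).1, h5⟩, by simp⟩
      · obtain ⟨i, y, hy, rfl⟩ := hK.exists_eq hx
        have hm := (Spqr_mem_of_mem hp hq hr (hI hy) i).2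
        have hi : i = 5 := by
          by_contra hne
          fin_cases i
          all_goals first
            | exact hne rfl
            | (simp [pqrLeft] at hm h5; linarith)
        subst hi
        have he : 1 - Spqr p q r 5 y = r * (1 - y) := by simp [Spqr]; ring
        rw [he, pow_succ'] at hlt
        obtain ⟨m, b, hb, hyb⟩ := ih y hy (lt_of_mul_lt_mul_left hlt hr.1.le)
        exact ⟨m + 1, b, hb, by rw [he, hyb]; ring⟩
  obtain ⟨N, hN⟩ := exists_pow_lt_of_lt_one (sub_pos.2 hx1) (hr.2.trans (by norm_num))
  exact key N x hx hN

open scoped Pointwise in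
/-- If `log p / log r` is rational, then points of the two touching pieces are uniformly apart on
the logarithmic scale centred at the common point. -/
theorem exists_log_gap (hp : p ∈ Ioo (0:ℝ) (1/36)) (hq : q ∈ Ioo (0:ℝ) (1/36))
    (hr : r ∈ Ioo (0:ℝ) (1/36)) (hK : IsAttractor (Spqr p q r) K)
    (h1 : UniqueOnePointIntersection p q r K) (hrat : ¬ Irrational (Real.log p / Real.log r)) :
    ∃ η > 0, ∀ x ∈ K, ∀ y ∈ K, 0 < x → y < 1 →
      η ≤ |Real.log (q * x) - Real.log (r * (1 - y))| := by
  have hlp : Real.log p < 0 := Real.log_neg hp.1 (hp.2.trans (by norm_num))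
  have hlr : Real.log r < 0 := Real.log_neg hr.1 (hr.2.trans (by norm_num))
  obtain ⟨c, hc⟩ : ∃ c : ℚ, (c : ℝ) = Real.log p / Real.log r := by
    simpa [Irrational] using hrat
  set g : ℝ := Real.log r / c.den with hg
  have hden : (c.den : ℝ) ≠ 0 := by exact_mod_cast c.den_nz
  have hg0 : g ≠ 0 := div_ne_zero hlr.ne hden
  have hgr : Real.log r = c.den * g := by rw [hg]; field_simp
  have hgp : Real.log p = c.num * g := by
    have h2 : Real.log p = c * Real.log r := by rw [hc]; field_simp [hlr.ne]
    rw [h2, hg, Rat.cast_def]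
    field_simp
  have hemb : Topology.IsClosedEmbedding fun l : ℤ => (Real.log q - Real.log r) + (l : ℝ) * g :=
    (Homeomorph.addLeft (Real.log q - Real.log r)).isClosedEmbedding.comp
      ((Homeomorph.mulRight₀ g hg0).isClosedEmbedding.comp Int.isClosedEmbedding_coe_real)
  set L : Set ℤ := {l | ∃ m n : ℕ, l = m * c.num - n * c.den} with hL
  set D : Set ℝ := (fun l : ℤ => (Real.log q - Real.log r) + (l : ℝ) * g) '' L with hD
  have hDc : IsClosed D := hemb.isClosedMap _ (isClosed_discrete L)
  have hAc : IsCompact (K ∩ Icc (1/5 : ℝ) 1) := hK.2.1.inter_right isClosed_Icc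
  have hBc : IsCompact (K ∩ Icc (0 : ℝ) (4/5)) := hK.2.1.inter_right isClosed_Icc
  set C : Set ℝ := (fun ab : ℝ × ℝ => Real.log ab.1 - Real.log (1 - ab.2)) ''
    ((K ∩ Icc (1/5 : ℝ) 1) ×ˢ (K ∩ Icc (0 : ℝ) (4/5))) with hC
  have hCc : IsCompact C := by
    refine (hAc.prod hBc).image_of_continuousOn (ContinuousOn.sub ?_ ?_)
    · refine continuousOn_fst.log ?_
      rintro ⟨a, b⟩ ⟨⟨-, ha, -⟩, -⟩
      simp only at ha ⊢
      linarith
    · refine (continuousOn_const.sub continuousOn_snd).log ?_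
      rintro ⟨a, b⟩ ⟨-, -, -, hb⟩
      change (1:ℝ) - b ≠ 0
      simp only at hb
      linarith
  have hclosed : IsClosed (D + C) := hDc.add_right_of_isCompact hCc
  have hval : ∀ (m n : ℕ) (a b : ℝ), 0 < a → b < 1 →
      Real.log (q * (p ^ m * a)) - Real.log (r * (r ^ n * (1 - b))) =
        ((Real.log q - Real.log r) + ((m * c.num - n * c.den : ℤ) : ℝ) * g) +
          (Real.log a - Real.log (1 - b)) := by
    intro m n a b ha hb
    have hb' : (1 - b) ≠ 0 := by linarith
    have hp0 := hp.1.ne'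
    have hq0 := hq.1.ne'
    have hr0 := hr.1.ne'
    rw [Real.log_mul hq0 (by positivity), Real.log_mul (by positivity) ha.ne', Real.log_pow,
      Real.log_mul hr0 (by positivity), Real.log_mul (by positivity) hb', Real.log_pow]
    push_cast
    linear_combination (m : ℝ) * hgp - (n : ℝ) * hgr
  have hzero : (0:ℝ) ∉ D + C := by
    rintro ⟨_, ⟨_, ⟨m, n, rfl⟩, rfl⟩, _, ⟨⟨a, b⟩, ⟨⟨haK, ha, -⟩, hbK, -, hb⟩, rfl⟩, hsum⟩
    simp only at ha hb hbK haK
    have ha0 : 0 < a := by linarith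
    have hb1 : b < 1 := by linarith
    have h2 := hval m n a b ha0 hb1
    have hpm : 0 < p ^ m := pow_pos hp.1 m
    have hrn : 0 < r ^ n := pow_pos hr.1 n
    have hlog : Real.log (q * (p ^ m * a)) = Real.log (r * (r ^ n * (1 - b))) :=
      sub_eq_zero.1 (h2.trans hsum)
    have heq := Real.log_injOn_pos
      (mem_Ioi.2 (mul_pos hq.1 (mul_pos hpm ha0)))
      (mem_Ioi.2 (mul_pos hr.1 (mul_pos hrn (sub_pos.2 hb1)))) hlog
    have := h1.eq_zero hq.1.ne' (hK.pow_mul_mem haK m) (hK.one_sub_pow_mul_mem hbK n)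
      (by rw [heq]; ring)
    exact (mul_pos hpm ha0).ne' this
  obtain ⟨η, hη, hball⟩ := Metric.isOpen_iff.1 hclosed.isOpen_compl 0 hzero
  refine ⟨η, hη, fun x hx y hy hx0 hy1 => ?_⟩
  obtain ⟨m, a, ha, rfl⟩ := exists_pow_mul_eq_of_pos hp hq hr hK hx hx0
  obtain ⟨n, b, hb, hyb⟩ := exists_pow_mul_eq_of_lt_one hp hq hr hK hy hy1
  rw [hyb]
  by_contra! hlt
  have hmem : Real.log (q * (p ^ m * a)) - Real.log (r * (r ^ n * (1 - b))) ∈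
      Metric.ball (0:ℝ) η := by
    simpa using hlt
  refine hball hmem ?_
  rw [hval m n a b (by linarith [ha.2.1]) (by linarith [hb.2.2])]
  exact add_mem_add ⟨_, ⟨m, n, rfl⟩, rfl⟩ ⟨(a, b), ⟨ha, hb⟩, rfl⟩

theorem satisfiesOSC_of_log_gap (hp : p ∈ Ioo (0:ℝ) (1/36)) (hq : q ∈ Ioo (0:ℝ) (1/36))
    (hr : r ∈ Ioo (0:ℝ) (1/36)) (hK : IsAttractor (Spqr p q r) K) (h0 : (0:ℝ) ∈ K) {η : ℝ}
    (hη : 0 < η) (hgap : ∀ x ∈ K, ∀ y ∈ K, 0 < x → y < 1 →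
      η ≤ |Real.log (q * x) - Real.log (r * (1 - y))|) : SatisfiesOSC (Spqr p q r) := by
  obtain ⟨ε, hε0, hε1, hε⟩ : ∃ ε > 0, ε < 1 ∧ ∀ u, |u - 1| < ε → |Real.log u| < η / 2 := by
    have hc := (Real.continuousAt_log one_ne_zero)
    obtain ⟨ε, hε, h⟩ := Metric.continuousAt_iff.1 hc (η / 2) (by positivity)
    refine ⟨min ε (1/2), by positivity, (min_le_right _ _).trans_lt (by norm_num), fun u hu => ?_⟩
    simpa [Real.dist_eq] using h (x := u) (hu.trans_le (min_le_left _ _))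
  set O : Set ℝ := ⋃ k ∈ K, {x | |x - k| < ε * x ∧ |x - k| < ε * (1 - x)} with hO
  have hmemO : ∀ {x}, x ∈ O ↔ ∃ k ∈ K, |x - k| < ε * x ∧ |x - k| < ε * (1 - x) := by
    simp only [hO, mem_iUnion, exists_prop, mem_ofPred_eq, implies_true]
  have hO01 : O ⊆ Ioo 0 1 := by
    intro x hx
    obtain ⟨k, -, h2, h3⟩ := hmemO.1 hx
    have h4 := abs_nonneg (x - k)
    exact ⟨pos_of_mul_pos_right (h4.trans_lt h2) hε0.le,
      sub_pos.1 (pos_of_mul_pos_right (h4.trans_lt h3) hε0.le)⟩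
  have hlog : ∀ {x k c : ℝ}, 0 < c → 0 < x → |x - k| < ε * x →
      0 < k ∧ |Real.log (c * k) - Real.log (c * x)| < η / 2 := by
    intro x k c hc hx hk
    have hk0 : 0 < k := by
      have := (abs_lt.1 hk).2
      nlinarith
    refine ⟨hk0, ?_⟩
    rw [← Real.log_div (by positivity) (by positivity), mul_div_mul_left _ _ hc.ne']
    refine hε _ ?_
    rw [div_sub_one hx.ne', abs_div, abs_of_pos hx, div_lt_iff₀ hx, abs_sub_comm]
    exact hk
  have h23 : Spqr p q r 2 '' O ∩ Spqr p q r 3 '' O = ∅ := by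
    rw [Set.eq_empty_iff_forall_notMem]
    rintro _ ⟨⟨x, hx, rfl⟩, y, hy, hxy⟩
    have hx0 := (hO01 hx).1
    have hy1 : 0 < 1 - y := sub_pos.2 (hO01 hy).2
    obtain ⟨k, hk, hkx, -⟩ := hmemO.1 hx
    obtain ⟨l, hl, -, hly⟩ := hmemO.1 hy
    have heq : q * x = r * (1 - y) := by
      simp [Spqr] at hxy
      linarith
    have hly' : |(1 - y) - (1 - l)| < ε * (1 - y) := by
      rw [show (1 - y) - (1 - l) = -(y - l) by ring, abs_neg]
      exact hly
    obtain ⟨hk0, hA⟩ := hlog hq.1 hx0 hkx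
    obtain ⟨hl1, hB⟩ := hlog hr.1 hy1 hly'
    rw [heq] at hA
    rw [abs_sub_comm] at hB
    have h5 := hgap k hk l hl hk0 (sub_pos.1 hl1)
    have h6 := abs_sub_le (Real.log (q * k)) (Real.log (r * (1 - y))) (Real.log (r * (1 - l)))
    linarith
  refine ⟨O, ⟨1/5, hmemO.2 ⟨1/5, hK.image_subset 1 ⟨0, h0, by simp [Spqr]⟩, ?_, ?_⟩⟩,
    ?_, ?_, ?_⟩
  · simpa using hε0
  · simp only [sub_self, abs_zero]
    linarith
  · exact isOpen_biUnion fun k _ =>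
      (isOpen_lt (f := fun x => |x - k|) (g := fun x => ε * x) (by fun_prop) (by fun_prop)).inter
        (isOpen_lt (f := fun x => |x - k|) (g := fun x => ε * (1 - x)) (by fun_prop)
          (by fun_prop))
  · rintro i _ ⟨x, hx, rfl⟩
    obtain ⟨hx0, hx1⟩ := hO01 hx
    obtain ⟨k, hk, hkx, hkx'⟩ := hmemO.1 hx
    refine hmemO.2 ⟨Spqr p q r i k, hK.image_subset i ⟨k, hk, rfl⟩, ?_⟩
    have habs : |Spqr p q r i x - Spqr p q r i k| = pqrRatio p q r i * |x - k| := by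
      have h2 := (Spqr_isSimilarity hp.1 hq.1 hr.1 i).2 x k
      rw [edist_nndist, edist_nndist, ← ENNReal.coe_mul, ENNReal.coe_inj] at h2
      rw [← Real.dist_eq, ← Real.dist_eq, ← coe_nndist, ← coe_nndist, h2, NNReal.coe_mul]
    have hρ : (pqrRatio p q r i : ℝ) ≤ 1/36 := by
      have := NNReal.coe_le_coe.2 (pqrRatio_le hp.2.le hq.2.le hr.2.le i)
      push_cast at this
      linarith
    have hρ0 : (0:ℝ) ≤ pqrRatio p q r i := NNReal.coe_nonneg _
    have hm := Spqr_mem_of_mem hp hq hr ⟨hx0.le, hx1.le⟩ i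
    have hsmall : pqrRatio p q r i * |x - k| < ε * (1/36) := by
      have h3 := abs_nonneg (x - k)
      have h4 : ε * x < ε := mul_lt_of_lt_one_right hε0 hx1
      nlinarith
    rw [habs]
    have hmid : 1/36 ≤ Spqr p q r i x → 1/36 ≤ 1 - Spqr p q r i x →
        pqrRatio p q r i * |x - k| < ε * Spqr p q r i x ∧
          pqrRatio p q r i * |x - k| < ε * (1 - Spqr p q r i x) := fun h3 h4 =>
      ⟨hsmall.trans_le (mul_le_mul_of_nonneg_left h3 hε0.le),
        hsmall.trans_le (mul_le_mul_of_nonneg_left h4 hε0.le)⟩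
    by_cases hi0 : i = 0
    · subst hi0
      refine ⟨?_, hsmall.trans_le (mul_le_mul_of_nonneg_left ?_ hε0.le)⟩
      · have h3 : (pqrRatio p q r 0 : ℝ) = p := Real.coe_toNNReal p hp.1.le
        have h4 : Spqr p q r 0 x = p * x := rfl
        rw [h3, h4, mul_left_comm]
        exact mul_lt_mul_of_pos_left hkx hp.1
      · have := hm.2
        simp [pqrLeft] at this
        linarith
    by_cases hi5 : i = 5
    · subst hi5
      refine ⟨hsmall.trans_le (mul_le_mul_of_nonneg_left ?_ hε0.le), ?_⟩
      · have := hm.1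
        simp [pqrLeft] at this
        linarith
      · have h3 : (pqrRatio p q r 5 : ℝ) = r := Real.coe_toNNReal r hr.1.le
        have h4 : 1 - Spqr p q r 5 x = r * (1 - x) := by simp [Spqr]; ring
        rw [h3, h4, mul_left_comm]
        exact mul_lt_mul_of_pos_left hkx' hr.1
    obtain ⟨h3, h4⟩ := hm
    fin_cases i
    · exact absurd rfl hi0
    all_goals first
      | exact absurd rfl hi5
      | (refine hmid ?_ ?_ <;> clear * - h3 h4 <;> simp [pqrLeft] at h3 h4 ⊢ <;> linarith)
  · intro i j hij
    by_cases hne : ({i, j} : Set (Fin 6)) = {2, 3}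
    · rcases Set.pair_eq_pair_iff.1 hne with ⟨rfl, rfl⟩ | ⟨rfl, rfl⟩
      · exact h23
      · rw [Set.inter_comm]
        exact h23
    · exact Spqr_disjoint_of_subset hp hq hr (hO01.trans Ioo_subset_Icc_self) hij hne

theorem mapClusterPt_nsmul_of_denseRange_zsmul {G : Type*} [AddCommGroup G] [TopologicalSpace G]
    [IsTopologicalAddGroup G] [CompactSpace G] {x y : G}
    (h : DenseRange (fun k : ℤ => k • y)) :
    MapClusterPt x Filter.atTop (fun k : ℕ => k • y) :=
  mapClusterPt_atTop_nsmul_iff_mem_topologicalClosure_zmultiples.2 (h x)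

theorem exists_natCast_mul_log_near {x y : ℝ} (hx : x < 0) (hy : y < 0) (hirr : Irrational (x / y))
    (c : ℝ) {ε : ℝ} (hε : 0 < ε) : ∃ m n : ℕ, |c + m * x - (n + 1) * y| < ε := by
  have : Fact (0 < -y) := ⟨neg_pos.2 hy⟩
  have hd : DenseRange (· • x : ℤ → AddCircle (-y)) :=
    AddCircle.denseRange_zsmul_coe_iff.2 (by rw [div_neg]; exact hirr.neg)
  have hcl : MapClusterPt ((-c : ℝ) : AddCircle (-y)) Filter.atTop
      (fun k : ℕ => k • (x : AddCircle (-y))) :=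
    mapClusterPt_nsmul_of_denseRange_zsmul (G := AddCircle (-y)) hd
  have hV : ((↑) : ℝ → AddCircle (-y)) '' Metric.ball (-c) ε ∈
      nhds ((-c : ℝ) : AddCircle (-y)) :=
    QuotientAddGroup.isOpenMap_coe.image_mem_nhds (Metric.ball_mem_nhds _ hε)
  have hfreq := hcl.frequently hV
  obtain ⟨N, hN⟩ := exists_nat_gt ((c + ε) / -x)
  obtain ⟨m, hm, z, hz, hzm⟩ := Filter.frequently_atTop.1 hfreq N
  rw [← AddCircle.coe_nsmul, QuotientAddGroup.eq, AddSubgroup.mem_zmultiples_iff] at hzm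
  obtain ⟨k, hk⟩ := hzm
  rw [Metric.mem_ball, Real.dist_eq] at hz
  have hk' : z = m * x + k * y := by
    simp only [zsmul_eq_mul, nsmul_eq_mul] at hk
    linarith
  have hmN : (N : ℝ) ≤ m := by exact_mod_cast hm
  rw [div_lt_iff₀ (neg_pos.2 hx)] at hN
  have hk0 : k < 0 := by
    by_contra! hk0
    have h1 : (0:ℝ) ≤ k := by exact_mod_cast hk0
    have h2 : (k : ℝ) * y ≤ 0 := mul_nonpos_of_nonneg_of_nonpos h1 hy.le
    have h3 := (abs_lt.1 hz).1
    nlinarith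
  obtain ⟨n, hn⟩ : ∃ n : ℕ, k = -((n : ℤ) + 1) := ⟨(-k - 1).toNat, by omega⟩
  refine ⟨m, n, ?_⟩
  have : c + m * x - (n + 1) * y = z - -c := by
    rw [hk', hn]
    push_cast
    ring
  rwa [this]

/-- The union of a compact set with a slightly rescaled copy of itself has content barely above the
Hausdorff measure of the set. -/
theorem exists_sizedContent_union_lt {s : ℝ} (hs : 0 < s) {X : Set ℝ} (hX : IsCompact X)
    (hX1 : X ⊆ Icc 0 1) {c : ℝ≥0∞} (hc : μH[s] X < c) :
    ∃ δ > 0, ∀ μ : ℝ, |μ - 1| < δ → sizedContent s 1 (X ∪ (μ * ·) '' X) < c := by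
  obtain ⟨U, hUo, hXU, hUd, hlt⟩ := exists_open_cover_of_sizedContent_lt hs ENNReal.one_half_lt_one
    ((sizedContent_le_hausdorffMeasure s (δ := 2⁻¹) (by simp) X).trans_lt hc)
  obtain ⟨δ, hδ, hth⟩ := hX.exists_thickening_subset_open (isOpen_iUnion hUo) hXU
  refine ⟨δ, hδ, fun μ hμ => ?_⟩
  have hsub : X ∪ (μ * ·) '' X ⊆ ⋃ n, U n := by
    refine union_subset hXU ?_
    rintro _ ⟨x, hx, rfl⟩
    refine hth (mem_thickening_iff.2 ⟨x, hx, ?_⟩)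
    obtain ⟨h0, h1⟩ := hX1 hx
    rw [Real.dist_eq, show μ * x - x = (μ - 1) * x by ring, abs_mul, abs_of_nonneg h0]
    exact (mul_le_of_le_one_right (abs_nonneg _) h1).trans_lt hμ
  calc sizedContent s 1 (X ∪ (μ * ·) '' X) ≤ sizedContent s 1 (⋃ n, U n) := measure_mono hsub
    _ ≤ ∑' n, sizedContent s 1 (U n) := measure_iUnion_le _
    _ ≤ ∑' n, ediam (U n) ^ s := ENNReal.tsum_le_tsum fun n => sizedContent_le_of_ediam_le (hUd n)
    _ < c := hlt

theorem hausdorffMeasure_attractor_eq_zero {s : ℝ} (hs : 0 < s) (hp : p ∈ Ioo (0:ℝ) (1/36))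
    (hq : q ∈ Ioo (0:ℝ) (1/36)) (hr : r ∈ Ioo (0:ℝ) (1/36)) (hK : IsAttractor (Spqr p q r) K)
    (h1 : UniqueOnePointIntersection p q r K) (hsim : p ^ s + q ^ s + 4 * r ^ s = 1)
    (hirr : Irrational (Real.log p / Real.log r)) : μH[s] K = 0 := by
  by_contra hne
  have hI := hK.subset_Icc hp hq hr
  have hlp : Real.log p < 0 := Real.log_neg hp.1 (hp.2.trans (by norm_num))
  have hlr : Real.log r < 0 := Real.log_neg hr.1 (hr.2.trans (by norm_num))
  set X := Spqr p q r 4 '' K with hX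
  have hS4 := Spqr_isSimilarity hp.1 hq.1 hr.1 4
  have hXK : X ⊆ K := hK.image_subset 4
  have hXc : IsCompact X := hK.2.1.image hS4.lipschitzWith.continuous
  have hfin : μH[s] X ≠ ∞ := ne_top_of_le_ne_top
    (hausdorffMeasure_attractor_ne_top hs hp hq hr hK hsim) (measure_mono hXK)
  have hpos : μH[s] X ≠ 0 := by
    rw [hX, hS4.hausdorffMeasure_image hs]
    refine mul_ne_zero ?_ hne
    simp [ENNReal.rpow_eq_zero_iff, hS4.1, hs.not_gt]
  have hlt : μH[s] X < μH[s] X + 2⁻¹ * μH[s] X :=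
    ENNReal.lt_add_right hfin (mul_ne_zero (by simp) hpos)
  obtain ⟨δ, hδ, hcov⟩ := exists_sizedContent_union_lt hs hXc (hXK.trans hI) hlt
  have hev : ∀ᶠ u : ℝ in nhds 0, |Real.exp (-u) - 1| < δ ∧ (1/2 : ℝ) < Real.exp (-u) ^ s := by
    refine Filter.Eventually.and ?_ ?_
    · have hcont : Continuous fun u : ℝ => |Real.exp (-u) - 1| := by fun_prop
      exact (hcont.tendsto 0).eventually_lt_const (by simpa using hδ)
    · have hcont : Continuous fun u : ℝ => Real.exp (-u) ^ s :=
        (Real.continuous_exp.comp continuous_neg).rpow_const fun _ => Or.inr hs.le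
      exact (hcont.tendsto 0).eventually_const_lt (by simp; norm_num)
  obtain ⟨ε, hε, hball⟩ := Metric.eventually_nhds_iff.1 hev
  obtain ⟨m, n, hmn⟩ := exists_natCast_mul_log_near hlp hlr hirr (Real.log q) hε
  set u := Real.log q + m * Real.log p - (n + 1) * Real.log r with hu
  obtain ⟨hμ, hμs⟩ := hball (y := u) (by simpa using hmn)
  set μ := Real.exp (-u) with hμdef
  have hμ0 : 0 < μ := Real.exp_pos _
  set t := q * p ^ m with ht
  have ht0 : 0 < t := mul_pos hq.1 (pow_pos hp.1 m)
  have ht1 : t ≤ 1 := mul_le_one₀ (hq.2.le.trans (by norm_num)) (pow_nonneg hp.1.le m)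
    (pow_le_one₀ hp.1.le (hp.2.le.trans (by norm_num)))
  have htμ : t * μ = r ^ (n + 1) := by
    have e1 : t = Real.exp (Real.log q + m * Real.log p) := by
      rw [Real.exp_add, Real.exp_log hq.1, Real.exp_nat_mul, Real.exp_log hp.1]
    have e2 : r ^ (n + 1) = Real.exp (((n + 1 : ℕ) : ℝ) * Real.log r) := by
      rw [Real.exp_nat_mul, Real.exp_log hr.1]
    rw [e1, e2, hμdef, ← Real.exp_add, hu]
    push_cast
    ring_nf
  set f : ℝ → ℝ := fun y => 8/15 - t * y with hf
  have hfs : IsSimilarity t.toNNReal f := isSimilarity_of_affine (b := 8/15) (c := -t)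
    (fun y => by rw [hf]; ring) (neg_ne_zero.2 ht0.ne') (by rw [abs_neg, abs_of_pos ht0])
  have hgs : IsSimilarity μ.toNNReal (μ * ·) := isSimilarity_of_affine (b := 0) (c := μ)
    (fun y => by ring) hμ0.ne' (abs_of_pos hμ0)
  have hfX : ∀ x ∈ X, f x ∈ K := fun x hx => hK.image_subset 2
    ⟨_, hK.pow_mul_mem (hXK hx) m, by simp [Spqr, hf, ht]; ring⟩
  have hX' : ∀ x ∈ X, 1 - x ∈ K := by
    rintro _ ⟨k, hk, rfl⟩
    exact hK.image_subset 1 ⟨k, hk, by simp [Spqr]; ring⟩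
  have hval : ∀ x, f (μ * x) = 8/15 - r * (r ^ n * x) := fun x => by
    rw [hf]
    simp only
    rw [← mul_assoc, htμ]
    ring
  have hgX : ∀ x ∈ X, f (μ * x) ∈ K := fun x hx => hK.image_subset 3
    ⟨_, hK.one_sub_pow_mul_mem (hX' x hx) n, by rw [hval]; simp [Spqr]; ring⟩
  have hX0 : ∀ x ∈ X, x ≠ 0 := by
    rintro _ ⟨k, hk, rfl⟩ h0
    have := (Spqr_mem_of_mem hp hq hr (hI hk) 4).1
    rw [h0] at this
    simp [pqrLeft] at this
    linarith
  have hdisj : Disjoint X ((μ * ·) '' X) := by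
    rw [Set.disjoint_left]
    rintro _ hx ⟨y, hy, rfl⟩
    have hx' : μ * y ∈ K := hXK hx
    have h2 := h1.eq_zero hq.1.ne' (hK.pow_mul_mem hx' m) (hK.one_sub_pow_mul_mem (hX' y hy) n)
      (by
        have h3 := hval y
        simp only [hf, ht] at h3
        linear_combination -h3)
    exact hX0 _ hx ((mul_eq_zero.1 h2).resolve_left (pow_pos hp.1 m).ne')
  have hμXc : IsCompact ((μ * ·) '' X) := hXc.image hgs.lipschitzWith.continuous
  have hYc : IsCompact (X ∪ (μ * ·) '' X) := hXc.union hμXc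
  have hsub : f '' (X ∪ (μ * ·) '' X) ⊆ K := by
    rintro _ ⟨_, hx | ⟨x, hx, rfl⟩, rfl⟩
    exacts [hfX _ hx, hgX x hx]
  have hle : μH[s] (X ∪ (μ * ·) '' X) ≤ sizedContent s 1 (X ∪ (μ * ·) '' X) := by
    have h2 := (hausdorffMeasure_le_sizedContent_of_subset hs hp hq hr hK hsim
      (hYc.image hfs.lipschitzWith.continuous).measurableSet hsub).trans
      (sizedContent_image_le hs hfs.1 hfs.lipschitzWith (δ := 1)
        (by rw [mul_one]; exact_mod_cast Real.toNNReal_le_one.2 ht1) _)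
    rw [hfs.hausdorffMeasure_image hs] at h2
    refine (ENNReal.mul_le_mul_iff_right ?_ ?_).1 h2
    · simp [ENNReal.rpow_eq_zero_iff, ht0, hs.not_gt]
    · simp [ENNReal.rpow_eq_top_iff, hs.not_gt]
  rw [measure_union hdisj hμXc.measurableSet, hgs.hausdorffMeasure_image hs] at hle
  have h4 := (ENNReal.add_lt_add_iff_left hfin).1 (hle.trans_lt (hcov μ hμ))
  have h5 := lt_of_mul_lt_mul_right' h4
  rw [show ((μ.toNNReal : ℝ≥0) : ℝ≥0∞) ^ s = ENNReal.ofReal (μ ^ s) from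
    ENNReal.ofReal_rpow_of_pos hμ0, ← one_div] at h5
  refine absurd h5 (not_lt.2 ?_)
  rw [ENNReal.le_ofReal_iff_toReal_le (by simp) (by positivity)]
  simpa using hμs.le

end System

/-- If `S_pqr` has unique one-point intersection but does not satisfy the open set
condition, then with `s` the similarity dimension (the unique `s > 0` with
`p^s + q^s + 4·r^s = 1`) the `s`-dimensional Hausdorff measure of the attractor vanishes,
even though `dim_H K = s`. -/
theorem stmt17 (p q r : ℝ) (hp : p ∈ Ioo (0:ℝ) (1/36)) (hq : q ∈ Ioo (0:ℝ) (1/36))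
    (hr : r ∈ Ioo (0:ℝ) (1/36)) (K : Set ℝ) (hK : IsAttractor (Spqr p q r) K)
    (huopi : UniqueOnePointIntersection p q r K)
    (hosc : ¬ SatisfiesOSC (Spqr p q r))
    (s : ℝ) (hs : 0 < s) (hsim : p ^ s + q ^ s + 4 * r ^ s = 1) :
    μH[s] K = 0 ∧ dimH K = ENNReal.ofReal s := by
  refine ⟨?_, le_antisymm ?_ (ofReal_le_dimH_attractor hs hp hq hr hK huopi hsim)⟩
  · refine hausdorffMeasure_attractor_eq_zero hs hp hq hr hK huopi hsim ?_
    by_contra hrat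
    obtain ⟨η, hη, hgap⟩ := exists_log_gap hp hq hr hK huopi hrat
    exact hosc (satisfiesOSC_of_log_gap hp hq hr hK (huopi.zero_mem hq.1.ne') hη hgap)
  · exact dimH_le_of_hausdorffMeasure_ne_top (d := s.toNNReal)
      (by rw [Real.coe_toNNReal _ hs.le]
          exact hausdorffMeasure_attractor_ne_top hs hp hq hr hK hsim)
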